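/- Fix positive integers k ≤ n and let ζ ∈ ℂ be a primitive n-th root of unity. Let the cyclic group ℤ/nℤ act on the set X of all k-element subsets of ℤ/nℤ by translation: d • S = {s + d : s ∈ S} (this is the action of the long cycle (1,2,…,n) on k-subsets of {1,…,n}). Then for every natural number d and every polynomial P ∈ ℂ[q] satisfying P · [k]!_q · [n−k]!_q = [n]!_q (so P is the Gaussian binomial coefficient [n choose k]_q), the number of k-element subsets S of ℤ/nℤ with {s + d : s ∈ S} = S equals P(ζ^d). -/

import Mathlib

open Polynomial

/-- The `q`-integer `[m]_q = 1 + q + ⋯ + q^(m-1)` as a polynomial over `ℂ`. -/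
noncomputable def qInt (m : ℕ) : Polynomial ℂ := ∑ i ∈ Finset.range m, X ^ i

/-- The `q`-factorial `[m]!_q = [m]_q [m-1]_q ⋯ [1]_q` as a polynomial over `ℂ`. -/
noncomputable def qFact : ℕ → Polynomial ℂ
  | 0 => 1
  | m + 1 => qFact m * qInt (m + 1)

/-- A finite set stable under translation by `a` is a union of cosets of the subgroup generated
by `a`, so it corresponds to a set of cosets. -/
noncomputable def translationFixedEquiv {G : Type*} [AddCommGroup G] [Fintype G] [DecidableEq G]
    (a : G) (k : ℕ) :
    {S : Finset G // S.card = k ∧ S.image (fun s => s + a) = S} ≃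
      {T : Finset (G ⧸ AddSubgroup.zmultiples a) // addOrderOf a * T.card = k} := by
  classical
  have card_preimage (T : Finset (G ⧸ AddSubgroup.zmultiples a)) :
      (Finset.univ.filter fun x : G => (x : G ⧸ AddSubgroup.zmultiples a) ∈ T).card =
        addOrderOf a * T.card := by
    have h := Nat.card_congr (QuotientAddGroup.preimageMkEquivAddSubgroupProdSet
      (AddSubgroup.zmultiples a) (T : Set (G ⧸ AddSubgroup.zmultiples a)))
    rw [Nat.card_prod, Nat.card_zmultiples, Nat.card_coe_set_eq, Nat.card_coe_set_eq,
      Set.ncard_coe_finset] at h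
    rw [← h, ← Set.ncard_coe_finset]
    congr 1
    ext x
    simp
  have preimage_image (S : Finset G) (hS : S.image (fun s => s + a) = S) :
      (Finset.univ.filter fun x : G => (x : G ⧸ AddSubgroup.zmultiples a) ∈
        S.image (fun s : G => (s : G ⧸ AddSubgroup.zmultiples a))) = S := by
    have step (s : G) (hs : s ∈ S) (i : ℕ) : s + i • a ∈ S := by
      induction i with
      | zero => simpa using hs
      | succ i ih =>
        rw [← hS, succ_nsmul, ← add_assoc]
        exact Finset.mem_image_of_mem _ ih
    ext x
    simp only [Finset.mem_filter, Finset.mem_univ, true_and, Finset.mem_image]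
    refine ⟨?_, fun hx => ⟨x, hx, rfl⟩⟩
    rintro ⟨s, hs, hsx⟩
    rw [QuotientAddGroup.eq, mem_zmultiples_iff_mem_range_addOrderOf] at hsx
    obtain ⟨i, -, hi⟩ := Finset.mem_image.1 hsx
    have := step s hs i
    have hi : i • a = -s + x := hi
    rwa [hi, add_neg_cancel_left] at this
  have image_preimage (T : Finset (G ⧸ AddSubgroup.zmultiples a)) :
      (Finset.univ.filter fun x : G => (x : G ⧸ AddSubgroup.zmultiples a) ∈ T).image
        (fun s : G => (s : G ⧸ AddSubgroup.zmultiples a)) = T := by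
    ext t
    obtain ⟨x, rfl⟩ := QuotientAddGroup.mk_surjective t
    simp only [Finset.mem_filter, Finset.mem_univ, true_and, Finset.mem_image]
    exact ⟨fun ⟨s, hs, hsx⟩ => hsx ▸ hs, fun hx => ⟨x, hx, rfl⟩⟩
  exact
  { toFun := fun S => ⟨S.1.image (fun s : G => (s : G ⧸ AddSubgroup.zmultiples a)), by
      rw [← card_preimage, preimage_image _ S.2.2, S.2.1]⟩
    invFun := fun T => ⟨Finset.univ.filter fun x : G => (x : G ⧸ AddSubgroup.zmultiples a) ∈ T.1,
      by rw [card_preimage, T.2], by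
        refine Finset.eq_of_subset_of_card_le ?_
          (Finset.card_image_of_injective _ (add_left_injective a)).ge
        intro y hy
        obtain ⟨x, hx, rfl⟩ := Finset.mem_image.1 hy
        simp only [Finset.mem_filter, Finset.mem_univ, true_and] at hx ⊢
        rwa [QuotientAddGroup.mk_add_of_mem x (AddSubgroup.mem_zmultiples a)]⟩
    left_inv := fun S => Subtype.ext (preimage_image _ S.2.2)
    right_inv := fun T => Subtype.ext (image_preimage _) }

theorem card_translationFixed_mul {G : Type*} [AddCommGroup G] [Fintype G] [DecidableEq G]
    (a : G) (g j : ℕ) (hg : Nat.card G = addOrderOf a * g) :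
    Nat.card {S : Finset G // S.card = addOrderOf a * j ∧ S.image (fun s => s + a) = S} =
      g.choose j := by
  classical
  have hpos : 0 < addOrderOf a := addOrderOf_pos a
  have hquot : Nat.card (G ⧸ AddSubgroup.zmultiples a) = g := by
    have h := AddSubgroup.card_eq_card_quotient_mul_card_addSubgroup (AddSubgroup.zmultiples a)
    rw [Nat.card_zmultiples, hg, mul_comm] at h
    exact (Nat.eq_of_mul_eq_mul_right hpos h).symm
  rw [Nat.card_congr (translationFixedEquiv a _)]
  simp only [Nat.mul_right_inj hpos.ne']
  rw [Nat.card_eq_fintype_card, Fintype.card_finset_len, ← Nat.card_eq_fintype_card, hquot]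

theorem card_translationFixed_of_not_dvd {G : Type*} [AddCommGroup G] [Fintype G]
    [DecidableEq G] (a : G) (k : ℕ) (hk : ¬ addOrderOf a ∣ k) :
    Nat.card {S : Finset G // S.card = k ∧ S.image (fun s => s + a) = S} = 0 := by
  rw [Nat.card_congr (translationFixedEquiv a _)]
  have : IsEmpty {T : Finset (G ⧸ AddSubgroup.zmultiples a) // addOrderOf a * T.card = k} :=
    ⟨fun T => hk ⟨_, T.2.symm⟩⟩
  exact Nat.card_of_isEmpty

/-- The cofactor of `[i]_q` after removing the factor `[m]_q` when `m ∣ i`. -/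
noncomputable def qIntCofactor (m i : ℕ) : ℂ[X] :=
  if m ∣ i then ∑ l ∈ Finset.range (i / m), (X ^ m) ^ l else qInt i

theorem qInt_mul_X_sub_one (m : ℕ) : qInt m * (X - 1) = X ^ m - 1 :=
  geom_sum_mul X m

theorem qInt_mul (m j : ℕ) : qInt (m * j) = qInt m * ∑ l ∈ Finset.range j, (X ^ m) ^ l := by
  have h : (X - 1 : ℂ[X]) ≠ 0 := X_sub_C_ne_zero (1 : ℂ)
  refine mul_right_cancel₀ h ?_
  rw [qInt_mul_X_sub_one, mul_right_comm, qInt_mul_X_sub_one, mul_geom_sum, pow_mul]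

theorem qFact_eq (m n : ℕ) (hm : 0 < m) :
    qFact n = qInt m ^ (n / m) * ∏ i ∈ Finset.range n, qIntCofactor m (i + 1) := by
  induction n with
  | zero => simp [qFact]
  | succ n ih =>
    rw [qFact, ih, Finset.prod_range_succ, Nat.succ_div, qIntCofactor]
    split_ifs with h
    · obtain ⟨j, hj⟩ := h
      rw [hj, qInt_mul, Nat.mul_div_cancel_left _ hm]
      ring
    · ring

theorem qInt_ne_zero {m : ℕ} (hm : 0 < m) : qInt m ≠ 0 := by
  intro h
  have := qInt_mul_X_sub_one m
  rw [h, zero_mul] at this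
  exact X_pow_sub_C_ne_zero hm (1 : ℂ) (by simpa using this.symm)

section Root

variable {ω : ℂ} {m : ℕ}

theorem eval_qIntCofactor_of_dvd (hω : IsPrimitiveRoot ω m) {j : ℕ} (hm : 0 < m) :
    (qIntCofactor m (m * j)).eval ω = j := by
  simp [qIntCofactor, eval_finsetSum, hω.pow_eq_one, Nat.mul_div_cancel_left _ hm]

theorem eval_qIntCofactor_of_not_dvd {i : ℕ} (hi : ¬ m ∣ i) :
    (qIntCofactor m i).eval ω * (ω - 1) = ω ^ i - 1 := by
  have h := congrArg (eval ω) (qInt_mul_X_sub_one i)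
  simpa [qIntCofactor, hi] using h

theorem eval_qIntCofactor_ne_zero (hω : IsPrimitiveRoot ω m) (hm : 0 < m) {i : ℕ} (hi : 0 < i) :
    (qIntCofactor m i).eval ω ≠ 0 := by
  by_cases h : m ∣ i
  · obtain ⟨j, rfl⟩ := h
    rw [eval_qIntCofactor_of_dvd hω hm]
    exact_mod_cast (Nat.pos_of_mul_pos_left hi).ne'
  · intro h0
    have := eval_qIntCofactor_of_not_dvd (ω := ω) h
    rw [h0, zero_mul] at this
    exact h (hω.dvd_of_pow_eq_one i (sub_eq_zero.1 this.symm))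

theorem eval_prod_qIntCofactor_ne_zero (hω : IsPrimitiveRoot ω m) (hm : 0 < m) (n : ℕ) :
    (∏ i ∈ Finset.range n, qIntCofactor m (i + 1)).eval ω ≠ 0 := by
  rw [eval_prod]
  exact Finset.prod_ne_zero_iff.2 fun i _ => eval_qIntCofactor_ne_zero hω hm i.succ_pos

theorem eval_qIntCofactor_add (hω : IsPrimitiveRoot ω m) (j : ℕ) {i : ℕ} (hi : ¬ m ∣ i) :
    (qIntCofactor m (m * j + i)).eval ω = (qIntCofactor m i).eval ω := by
  have h1 : ω - 1 ≠ 0 := by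
    intro h
    rw [sub_eq_zero] at h
    have : m ∣ 1 := hω.dvd_of_pow_eq_one 1 (by simpa using h)
    exact hi (this.trans (one_dvd i))
  refine mul_right_cancel₀ h1 ?_
  rw [eval_qIntCofactor_of_not_dvd hi, eval_qIntCofactor_of_not_dvd
    (by rwa [Nat.dvd_add_right (dvd_mul_right m j)]), pow_add, pow_mul, hω.pow_eq_one, one_pow,
    one_mul]

theorem eval_prod_qIntCofactor_mul (hω : IsPrimitiveRoot ω m) (hm : 0 < m) (j : ℕ) :
    (∏ i ∈ Finset.range (m * j), qIntCofactor m (i + 1)).eval ω =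
      j.factorial * (∏ i ∈ Finset.range (m - 1), (qIntCofactor m (i + 1)).eval ω) ^ j := by
  induction j with
  | zero => simp
  | succ j ih =>
    rw [Nat.mul_succ, Finset.prod_range_add, eval_mul, ih, eval_prod]
    obtain ⟨r, rfl⟩ : ∃ r, m = r + 1 := ⟨m - 1, by omega⟩
    rw [Finset.prod_range_succ, add_tsub_cancel_right, add_assoc, ← Nat.mul_succ,
      eval_qIntCofactor_of_dvd hω hm]
    have hshift : ∀ i ∈ Finset.range r,
        (qIntCofactor (r + 1) ((r + 1) * j + i + 1)).eval ω =
          (qIntCofactor (r + 1) (i + 1)).eval ω := fun i hi => by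
      rw [add_assoc, eval_qIntCofactor_add hω j
        (Nat.not_dvd_of_pos_of_lt i.succ_pos (by have := Finset.mem_range.1 hi; omega))]
    rw [Finset.prod_congr rfl hshift, Nat.factorial_succ]
    push_cast
    ring

theorem eval_qBinomial_mul (hω : IsPrimitiveRoot ω m) (hm : 0 < m) {g j : ℕ} (hj : j ≤ g)
    {P : ℂ[X]} (hP : P * qFact (m * j) * qFact (m * g - m * j) = qFact (m * g)) :
    P.eval ω = g.choose j := by
  obtain ⟨l, rfl⟩ := Nat.exists_eq_add_of_le hj
  rw [Nat.mul_add, Nat.add_sub_cancel_left, ← Nat.mul_add, qFact_eq m _ hm,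
    qFact_eq m (m * l) hm, qFact_eq m (m * (j + l)) hm] at hP
  simp only [Nat.mul_div_cancel_left _ hm] at hP
  have hP' := mul_left_cancel₀ (pow_ne_zero (j + l) (qInt_ne_zero hm))
    ((by rw [← hP]; ring :
      qInt m ^ (j + l) * (P * (∏ i ∈ Finset.range (m * j), qIntCofactor m (i + 1)) *
        ∏ i ∈ Finset.range (m * l), qIntCofactor m (i + 1)) = _))
  have h := congrArg (eval ω) hP'
  have hne := eval_prod_qIntCofactor_ne_zero hω hm (m * (j + l))
  rw [eval_mul, eval_mul, eval_prod_qIntCofactor_mul hω hm, eval_prod_qIntCofactor_mul hω hm,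
    eval_prod_qIntCofactor_mul hω hm] at h
  rw [eval_prod_qIntCofactor_mul hω hm, pow_add] at hne
  have hc := right_ne_zero_of_mul hne
  have hfact : ((j + l).factorial : ℂ) = (j + l).choose j * j.factorial * l.factorial := by
    have := Nat.add_choose_mul_factorial_mul_factorial j l
    rw [Nat.choose_symm_add] at *
    exact_mod_cast this.symm
  rw [hfact, pow_add] at h
  have hj0 : (j.factorial : ℂ) ≠ 0 := by exact_mod_cast j.factorial_ne_zero
  have hl0 : (l.factorial : ℂ) ≠ 0 := by exact_mod_cast l.factorial_ne_zero
  refine mul_right_cancel₀ (mul_ne_zero (mul_ne_zero hj0 hl0) hc) ?_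
  linear_combination h

theorem eval_qBinomial_of_not_dvd (hω : IsPrimitiveRoot ω m) (hm : 0 < m) {g k : ℕ}
    (hk : k ≤ m * g) (hmk : ¬ m ∣ k) {P : ℂ[X]}
    (hP : P * qFact k * qFact (m * g - k) = qFact (m * g)) :
    P.eval ω = 0 := by
  have hm1 : 1 < m := by
    by_contra h
    obtain rfl : m = 1 := by omega
    exact hmk (one_dvd k)
  have hdiv : g = k / m + (m * g - k) / m + 1 := by
    obtain ⟨l, hl⟩ := Nat.exists_eq_add_of_le hk
    rw [hl, Nat.add_sub_cancel_left]
    have hg : g = (k + l) / m := by rw [← hl, Nat.mul_div_cancel_left _ hm]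
    have hmod : (k % m + l % m) % m = 0 := by
      rw [← Nat.add_mod, ← hl, Nat.mul_mod_right]
    have hk0 : 0 < k % m := Nat.pos_of_ne_zero fun h => hmk (Nat.dvd_of_mod_eq_zero h)
    have hle : m ≤ k % m + l % m := Nat.le_of_dvd (by omega) (Nat.dvd_of_mod_eq_zero hmod)
    rw [hg, Nat.add_div hm, if_pos hle]
  rw [qFact_eq m k hm, qFact_eq m (m * g - k) hm, qFact_eq m (m * g) hm,
    Nat.mul_div_cancel_left _ hm] at hP
  have hP' := mul_left_cancel₀
    (pow_ne_zero (k / m + (m * g - k) / m) (qInt_ne_zero hm))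
    ((by
      have hpow : qInt m ^ g = qInt m ^ (k / m + (m * g - k) / m) * qInt m := by
        rw [← pow_succ, ← hdiv]
      rw [← mul_assoc _ (qInt m), ← hpow, ← hP]; ring :
      qInt m ^ (k / m + (m * g - k) / m) *
        (P * (∏ i ∈ Finset.range k, qIntCofactor m (i + 1)) *
          ∏ i ∈ Finset.range (m * g - k), qIntCofactor m (i + 1)) =
      qInt m ^ (k / m + (m * g - k) / m) *
        (qInt m * ∏ i ∈ Finset.range (m * g), qIntCofactor m (i + 1))))
  have h := congrArg (eval ω) hP'
  have hQ : (qInt m).eval ω = 0 := by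
    simpa [qInt, eval_finsetSum] using hω.geom_sum_eq_zero hm1
  rw [eval_mul, eval_mul, eval_mul, hQ, zero_mul] at h
  simpa [eval_prod_qIntCofactor_ne_zero hω hm] using h

end Root

/-- **Cyclic sieving for `k`-element subsets (Reiner–Stanton–White).**
Fix positive integers `k ≤ n` and a primitive `n`-th root of unity `ζ`.  The cyclic group
`ℤ/nℤ` acts on `k`-element subsets of `ℤ/nℤ` by translation.  For every `d` and every
polynomial `P` with `P · [k]!_q · [n-k]!_q = [n]!_q` (i.e. the Gaussian binomial
`[n choose k]_q`), the number of `k`-subsets fixed by translation by `d` is `P(ζ^d)`. -/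
theorem csp_subsets (n k : ℕ) (hk : 0 < k) (hkn : k ≤ n)
    (ζ : ℂ) (hζ : IsPrimitiveRoot ζ n) (d : ℕ)
    (P : Polynomial ℂ) (hP : P * qFact k * qFact (n - k) = qFact n) :
    (Nat.card {S : Finset (ZMod n) // S.card = k ∧
        S.image (fun s => s + (d : ZMod n)) = S} : ℂ) = P.eval (ζ ^ d) := by
  have hn : 0 < n := hk.trans_le hkn
  have : NeZero n := ⟨hn.ne'⟩
  have horder : addOrderOf (d : ZMod n) = orderOf (ζ ^ d) := by
    rw [ZMod.addOrderOf_coe d hn.ne', hζ.isOfFinOrder hn.ne' |>.orderOf_pow, ← hζ.eq_orderOf]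
  have hω : IsPrimitiveRoot (ζ ^ d) (addOrderOf (d : ZMod n)) := by
    rw [horder]
    exact IsPrimitiveRoot.orderOf _
  have hm : 0 < addOrderOf (d : ZMod n) := addOrderOf_pos _
  obtain ⟨g, hg⟩ := addOrderOf_dvd_natCard (d : ZMod n)
  have hng : n = addOrderOf (d : ZMod n) * g := by rw [← hg, Nat.card_zmod]
  by_cases hdvd : addOrderOf (d : ZMod n) ∣ k
  · obtain ⟨j, hj⟩ := hdvd
    have hjg : j ≤ g := Nat.le_of_mul_le_mul_left (by rwa [← hj, ← hng]) hm
    have hP' : P * qFact (addOrderOf (d : ZMod n) * j) *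
        qFact (addOrderOf (d : ZMod n) * g - addOrderOf (d : ZMod n) * j) =
        qFact (addOrderOf (d : ZMod n) * g) := by
      rwa [← hj, ← hng]
    rw [eval_qBinomial_mul hω hm hjg hP', hj, card_translationFixed_mul _ g j hg]
  · have hP' : P * qFact k * qFact (addOrderOf (d : ZMod n) * g - k) =
        qFact (addOrderOf (d : ZMod n) * g) := by
      rwa [← hng]
    rw [eval_qBinomial_of_not_dvd hω hm (hng ▸ hkn) hdvd hP',
      card_translationFixed_of_not_dvd _ k hdvd, Nat.cast_zero]
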